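/- For every n ≥ 0, Σ_{σ ∈ S_n(123,132,213)} x^{s(σ)} y^{d(σ)} q^{maj(σ)} = Σ_{α} x^{s(α)} y^{d(α)} q^{rb(α)}, as an identity in ℤ[x,y,q], where the right-hand sum runs over all partitions α of the set [n] into consecutive intervals each of size at most 2 (the layered matching partitions of [n], which Goyt showed are exactly the partitions of [n] avoiding the partition patterns 13/2 and 123). -/

import Mathlib

open Finset MvPolynomial

open scoped Classical

/-- `σ` (a permutation of `[n]` in one-line notation `σ 0, …, σ (n-1)`) contains the
pattern `π` (given by its one-line notation as a function `Fin m → Fin m`) if some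
subsequence of `σ` is order isomorphic to `π`. -/
def PermContains {n m : ℕ} (σ : Equiv.Perm (Fin n)) (π : Fin m → Fin m) : Prop :=
  ∃ f : Fin m → Fin n, (∀ a b : Fin m, a < b → f a < f b) ∧
    ∀ a b : Fin m, σ (f a) < σ (f b) ↔ π a < π b

/-- `σ` avoids the pattern `π`. -/
def PermAvoids {n m : ℕ} (σ : Equiv.Perm (Fin n)) (π : Fin m → Fin m) : Prop :=
  ¬ PermContains σ π

/-- The value `σ i` of the one-line notation of `σ`, as a natural number (0-based). -/
def permVal {n : ℕ} (σ : Equiv.Perm (Fin n)) (i : ℕ) : ℕ :=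
  if h : i < n then (σ ⟨i, h⟩ : ℕ) else 0

/-- `inv σ` : the number of inversions, i.e. pairs of positions `i < j` with `σ i > σ j`. -/
def invStat {n : ℕ} (σ : Equiv.Perm (Fin n)) : ℕ :=
  ((Finset.range n ×ˢ Finset.range n).filter
    fun p => p.1 < p.2 ∧ permVal σ p.2 < permVal σ p.1).card

/-- `maj σ` : the sum of all (1-based) indices `i` with `σ(i) > σ(i+1)`; with 0-based
positions, a descent at positions `i, i+1` contributes `i + 1`. -/
def majStat {n : ℕ} (σ : Equiv.Perm (Fin n)) : ℕ :=
  ∑ i ∈ Finset.range (n - 1), if permVal σ (i + 1) < permVal σ i then i + 1 else 0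

/-- The number of ascents of `σ`; for `σ ∈ Sₙ(123,132,213)` (a reverse layered matching)
this equals `d σ`, the number of doubleton blocks. -/
def ascStat {n : ℕ} (σ : Equiv.Perm (Fin n)) : ℕ :=
  ((Finset.range (n - 1)).filter fun i => permVal σ i < permVal σ (i + 1)).card

/-- The number of descents of `σ`; for `σ ∈ Sₙ(231,312,321)` (a layered matching)
this equals `d σ`, the number of doubleton blocks. -/
def descStat {n : ℕ} (σ : Equiv.Perm (Fin n)) : ℕ :=
  ((Finset.range (n - 1)).filter fun i => permVal σ (i + 1) < permVal σ i).card

/-- `Sₙ(123, 132, 213)` : permutations of `[n]` avoiding `123`, `132` and `213`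
(patterns written 0-based). -/
noncomputable def S123 (n : ℕ) : Finset (Equiv.Perm (Fin n)) :=
  Finset.univ.filter fun σ =>
    PermAvoids σ ![0, 1, 2] ∧ PermAvoids σ ![0, 2, 1] ∧ PermAvoids σ ![1, 0, 2]

/-- `Sₙ(231, 312, 321)` : permutations of `[n]` avoiding `231`, `312` and `321`
(patterns written 0-based). -/
noncomputable def S231 (n : ℕ) : Finset (Equiv.Perm (Fin n)) :=
  Finset.univ.filter fun σ =>
    PermAvoids σ ![1, 2, 0] ∧ PermAvoids σ ![2, 0, 1] ∧ PermAvoids σ ![2, 1, 0]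

/-- Given a list `L` of block sizes (splitting positions `0, …, L.sum - 1` into consecutive
blocks), `blockIdx L i` is the index (0-based) of the block containing position `i`. -/
def blockIdx (L : List ℕ) (i : ℕ) : ℕ :=
  ((L.scanl (· + ·) 0).tail).countP fun s => decide (s ≤ i)

/-- The partitions of `[n]` into consecutive intervals each of size at most 2, encoded by
their lists of block sizes (each block size is 1 or 2, and the sizes sum to `n`). -/
def intervalParts (n : ℕ) : Finset (List ℕ) :=
  (((Finset.range (n + 1)).biUnion fun k =>
      (Finset.univ : Finset (Fin k → Bool)).image fun v =>
        (List.ofFn v).map fun b => if b then 2 else 1)).filter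
    fun L => L.sum = n

/-- `rb` of the partition of `[n]` into consecutive intervals with size list `L`
(elements written 0-based): the number of right bigger pairs `(b, Bⱼ)`, i.e. pairs of an
element `b` lying in a block `Bᵢ` with `i < j` and `max Bⱼ > b`. -/
def rbL (n : ℕ) (L : List ℕ) : ℕ :=
  ((Finset.range n ×ˢ Finset.range L.length).filter fun p =>
    blockIdx L p.1 < p.2 ∧
      ((Finset.range n).filter fun c => blockIdx L c = p.2 ∧ p.1 < c).Nonempty).card

/-- Avoiding `123`, `132` and `213` means that all non-inversions are between adjacent
positions. -/
lemma mem_S123_iff {n : ℕ} {σ : Equiv.Perm (Fin n)} :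
    σ ∈ S123 n ↔ ∀ i j : Fin n, i < j → σ i < σ j → (j : ℕ) = i + 1 := by
  have hmono : ∀ i k j : Fin n, i < k → k < j → ∀ a b : Fin 3, a < b →
      ![i, k, j] a < ![i, k, j] b := by
    intro i k j hik hkj a b hab
    fin_cases a <;> fin_cases b <;> simp_all
    exact hik.trans hkj
  simp only [S123, Finset.mem_filter, Finset.mem_univ, true_and]
  constructor
  · rintro ⟨h1, h2, h3⟩ i j hij hσ
    by_contra hne
    have hlt : (i : ℕ) < j := hij
    obtain ⟨k, hik, hkj⟩ : ∃ k : Fin n, i < k ∧ k < j :=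
      ⟨⟨i + 1, by omega⟩, by simp [Fin.lt_def], by simp only [Fin.lt_def]; omega⟩
    have hki : σ k ≠ σ i := fun h => hik.ne' (σ.injective h)
    have hkj' : σ k ≠ σ j := fun h => hkj.ne (σ.injective h)
    rcases lt_or_gt_of_ne hki with h | h
    · refine h3 ⟨![i, k, j], hmono i k j hik hkj, fun a b => ?_⟩
      fin_cases a <;> fin_cases b <;> simp <;> order
    · rcases lt_or_gt_of_ne hkj' with h' | h'
      · refine h1 ⟨![i, k, j], hmono i k j hik hkj, fun a b => ?_⟩
        fin_cases a <;> fin_cases b <;> simp <;> order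
      · refine h2 ⟨![i, k, j], hmono i k j hik hkj, fun a b => ?_⟩
        fin_cases a <;> fin_cases b <;> simp <;> order
  · intro h
    have key : ∀ π : Fin 3 → Fin 3, π 0 < π 2 → PermAvoids σ π := by
      rintro π hπ ⟨f, hf, hσ⟩
      have h01 : (f 0 : ℕ) < f 1 := hf 0 1 (by decide)
      have h12 : (f 1 : ℕ) < f 2 := hf 1 2 (by decide)
      have := h (f 0) (f 2) (hf 0 2 (by decide)) ((hσ 0 2).2 hπ)
      omega
    exact ⟨key _ (by decide), key _ (by decide), key _ (by decide)⟩

/-- The set of (0-based) ascent positions. -/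
noncomputable def ascSet {n : ℕ} (σ : Equiv.Perm (Fin n)) : Finset ℕ :=
  (Finset.range (n - 1)).filter fun i => permVal σ i < permVal σ (i + 1)

/-- The subsets of `{0, …, n - 2}` without two consecutive elements. -/
noncomputable def sparseSets (n : ℕ) : Finset (Finset ℕ) :=
  (Finset.range (n - 1)).powerset.filter fun A => ∀ i ∈ A, i + 1 ∉ A

lemma mem_sparseSets {n : ℕ} {A : Finset ℕ} :
    A ∈ sparseSets n ↔ (∀ i ∈ A, i + 1 < n) ∧ ∀ i ∈ A, i + 1 ∉ A := by
  simp only [sparseSets, Finset.mem_filter, Finset.mem_powerset, Finset.subset_iff,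
    Finset.mem_range]
  refine and_congr_left fun _ => forall₂_congr fun i _ => ?_
  omega

/-- The sum of the (1-based) positions in `{1, …, n - 1}` outside `A`. -/
noncomputable def coSum (n : ℕ) (A : Finset ℕ) : ℕ :=
  ∑ i ∈ Finset.range (n - 1), if i ∈ A then 0 else i + 1

lemma permVal_of_lt {n : ℕ} (σ : Equiv.Perm (Fin n)) {i : ℕ} (h : i < n) :
    permVal σ i = σ ⟨i, h⟩ := by
  simp [permVal, h]

lemma mem_ascSet {n : ℕ} {σ : Equiv.Perm (Fin n)} {i : ℕ} :
    i ∈ ascSet σ ↔ ∃ h : i + 1 < n, σ ⟨i, by omega⟩ < σ ⟨i + 1, h⟩ := by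
  simp only [ascSet, Finset.mem_filter, Finset.mem_range]
  constructor
  · rintro ⟨h, h'⟩
    refine ⟨by omega, ?_⟩
    rwa [permVal_of_lt σ (by omega), permVal_of_lt σ (by omega)] at h'
  · rintro ⟨h, h'⟩
    refine ⟨by omega, ?_⟩
    rwa [permVal_of_lt σ (by omega), permVal_of_lt σ (by omega)]

lemma majStat_eq_coSum {n : ℕ} (σ : Equiv.Perm (Fin n)) :
    majStat σ = coSum n (ascSet σ) := by
  refine Finset.sum_congr rfl fun i hi => ?_
  have hi' := Finset.mem_range.1 hi
  have hne : permVal σ i ≠ permVal σ (i + 1) := by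
    rw [permVal_of_lt σ (show i < n by omega), permVal_of_lt σ (show i + 1 < n by omega)]
    intro h
    have := σ.injective (Fin.ext h)
    simp at this
  simp only [ascSet, Finset.mem_filter, hi, true_and]
  split_ifs <;> first | rfl | omega

lemma lt_iff_of_mem_S123 {n : ℕ} {σ : Equiv.Perm (Fin n)} (hσ : σ ∈ S123 n) {i j : Fin n}
    (hij : i < j) : σ i < σ j ↔ (j : ℕ) = i + 1 ∧ (i : ℕ) ∈ ascSet σ := by
  rw [mem_ascSet]
  constructor
  · intro h
    have hj := mem_S123_iff.1 hσ i j hij h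
    refine ⟨hj, by omega, ?_⟩
    convert h
    exact hj.symm
  · rintro ⟨hj, h, h'⟩
    convert h'

lemma ascSet_mem_sparseSets {n : ℕ} {σ : Equiv.Perm (Fin n)} (hσ : σ ∈ S123 n) :
    ascSet σ ∈ sparseSets n := by
  refine mem_sparseSets.2 ⟨fun i hi => (mem_ascSet.1 hi).1, fun i hi hi' => ?_⟩
  obtain ⟨h, h1⟩ := mem_ascSet.1 hi
  obtain ⟨h', h2⟩ := mem_ascSet.1 hi'
  have := mem_S123_iff.1 hσ ⟨i, by omega⟩ ⟨i + 1 + 1, h'⟩ (by simp [Fin.lt_def])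
    (h1.trans h2)
  simp at this

lemma ascSet_injOn (n : ℕ) : Set.InjOn (ascSet (n := n)) (S123 n) := by
  intro σ hσ τ hτ h
  have hlt : ∀ i j, i < j → (σ i < σ j ↔ τ i < τ j) := fun i j hij => by
    rw [lt_iff_of_mem_S123 hσ hij, lt_iff_of_mem_S123 hτ hij, h]
  have hmono : StrictMono (σ ∘ τ.symm) := by
    intro a b hab
    obtain ⟨i, rfl⟩ := τ.surjective a
    obtain ⟨j, rfl⟩ := τ.surjective b
    simp only [Function.comp_apply, Equiv.symm_apply_apply]
    rcases lt_trichotomy i j with hij | rfl | hij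
    · exact (hlt i j hij).2 hab
    · exact absurd hab (lt_irrefl _)
    · have h1 : ¬ σ j < σ i := fun h' => hab.asymm ((hlt j i hij).1 h')
      exact lt_of_le_of_ne (not_lt.1 h1) fun h' => hij.ne' (σ.injective h')
  have hid : σ ∘ τ.symm = id :=
    (hmono.range_inj strictMono_id).1 (by
      rw [Set.range_id, (σ.surjective.comp τ.symm.surjective).range_eq])
  ext i
  have := congrFun hid (τ i)
  simp only [Function.comp_apply, Equiv.symm_apply_apply, id] at this
  rw [this]

/-- The involution exchanging `i` and `i + 1` for every `i ∈ A`, when `A` is sparse. -/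
noncomputable def sparseSwap (A : Finset ℕ) (i : ℕ) : ℕ :=
  if i ∈ A then i + 1 else if 1 ≤ i ∧ i - 1 ∈ A then i - 1 else i

lemma sparseSwap_lt {n : ℕ} {A : Finset ℕ} (hA : A ∈ sparseSets n) {i : ℕ} (hi : i < n) :
    sparseSwap A i < n := by
  have := (mem_sparseSets.1 hA).1 i
  unfold sparseSwap
  split_ifs with h
  · exact this h
  · omega
  · exact hi

lemma sparseSwap_sparseSwap {n : ℕ} {A : Finset ℕ} (hA : A ∈ sparseSets n) (i : ℕ) :
    sparseSwap A (sparseSwap A i) = i := by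
  have hs := (mem_sparseSets.1 hA).2
  by_cases h : i ∈ A
  · simp [sparseSwap, h, hs i h]
  · by_cases h' : 1 ≤ i ∧ i - 1 ∈ A
    · simp [sparseSwap, h, h']
    · simp [sparseSwap, h, h']

lemma exists_mem_S123_of_mem_sparseSets {n : ℕ} {A : Finset ℕ} (hA : A ∈ sparseSets n) :
    ∃ σ ∈ S123 n, ascSet σ = A := by
  obtain ⟨hlt, hs⟩ := mem_sparseSets.1 hA
  let τ : Fin n → Fin n := fun i => ⟨sparseSwap A i, sparseSwap_lt hA i.2⟩
  have hτ : Function.Involutive τ := fun i => Fin.ext (sparseSwap_sparseSwap hA i)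
  let σ : Equiv.Perm (Fin n) := hτ.toPerm.trans Fin.revPerm
  have hσ : ∀ i j, σ i < σ j ↔ sparseSwap A j < sparseSwap A i := fun i j => by
    simp [σ, τ, Fin.lt_def]
    have := sparseSwap_lt hA i.2
    have := sparseSwap_lt hA j.2
    omega
  refine ⟨σ, mem_S123_iff.2 fun i j hij h => ?_, ?_⟩
  · rw [hσ] at h
    have hij' : (i : ℕ) < j := hij
    unfold sparseSwap at h
    split_ifs at h <;> omega
  · ext i
    simp only [mem_ascSet, hσ]
    constructor
    · rintro ⟨h, h'⟩
      by_contra hi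
      simp only [sparseSwap, hi, if_false, Nat.add_sub_cancel, and_false] at h'
      split_ifs at h' <;> omega
    · intro hi
      exact ⟨hlt i hi, by simp [sparseSwap, hi, hs i hi]⟩

lemma two_mul_card_le_of_mem_sparseSets {n : ℕ} {A : Finset ℕ} (hA : A ∈ sparseSets n) :
    2 * A.card ≤ n := by
  obtain ⟨hlt, hs⟩ := mem_sparseSets.1 hA
  have hdisj : Disjoint A (A.image Nat.succ) := by
    rw [Finset.disjoint_right]
    intro a ha
    obtain ⟨i, hi, rfl⟩ := Finset.mem_image.1 ha
    exact hs i hi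
  have hsub : A ∪ A.image Nat.succ ⊆ Finset.range n := by
    intro a ha
    rcases Finset.mem_union.1 ha with ha | ha
    · exact Finset.mem_range.2 (by have := hlt a ha; omega)
    · obtain ⟨i, hi, rfl⟩ := Finset.mem_image.1 ha
      exact Finset.mem_range.2 (hlt i hi)
  have := Finset.card_le_card hsub
  rw [Finset.card_union_of_disjoint hdisj, Finset.card_image_of_injective _ Nat.succ_injective,
    Finset.card_range] at this
  omega

lemma sparseSets_add_two (n : ℕ) :
    sparseSets (n + 2) = sparseSets (n + 1) ∪ (sparseSets n).image (insert n) := by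
  ext A
  simp only [Finset.mem_union, Finset.mem_image]
  constructor
  · intro hA
    obtain ⟨hlt, hs⟩ := mem_sparseSets.1 hA
    by_cases hn : n ∈ A
    · refine Or.inr ⟨A.erase n, mem_sparseSets.2 ⟨fun i hi => ?_, fun i hi hi' => ?_⟩,
        Finset.insert_erase hn⟩
      · obtain ⟨hne, hi⟩ := Finset.mem_erase.1 hi
        have h1 := hlt i hi
        have h2 : i + 1 ≠ n := fun h => hs i hi (h ▸ hn)
        omega
      · exact hs i (Finset.mem_of_mem_erase hi) (Finset.mem_of_mem_erase hi')
    · refine Or.inl (mem_sparseSets.2 ⟨fun i hi => ?_, hs⟩)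
      have h1 := hlt i hi
      have h2 : i ≠ n := fun h => hn (h ▸ hi)
      omega
  · rintro (hA | ⟨C, hC, rfl⟩)
    · obtain ⟨hlt, hs⟩ := mem_sparseSets.1 hA
      exact mem_sparseSets.2 ⟨fun i hi => (hlt i hi).trans (by omega), hs⟩
    · obtain ⟨hlt, hs⟩ := mem_sparseSets.1 hC
      refine mem_sparseSets.2 ⟨fun i hi => ?_, fun i hi hi' => ?_⟩
      · rcases Finset.mem_insert.1 hi with rfl | hi
        · omega
        · have := hlt i hi; omega
      · rcases Finset.mem_insert.1 hi with rfl | hi <;>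
          rcases Finset.mem_insert.1 hi' with h | hi'
        · omega
        · have := hlt _ hi'; omega
        · have := hlt i hi; omega
        · exact hs i hi hi'

lemma notMem_of_mem_sparseSets {n k : ℕ} {A : Finset ℕ} (hA : A ∈ sparseSets n)
    (hk : n ≤ k + 1) : k ∉ A := fun h => by
  have := (mem_sparseSets.1 hA).1 k h
  omega

lemma coSum_add_two_of_mem {n : ℕ} {A : Finset ℕ} (hA : A ∈ sparseSets (n + 1)) :
    coSum (n + 2) A = coSum (n + 1) A + (n + 1) := by
  simp [coSum, Finset.sum_range_succ, notMem_of_mem_sparseSets hA le_rfl]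

lemma coSum_add_two_insert {n : ℕ} {C : Finset ℕ} (hC : C ∈ sparseSets n) :
    coSum (n + 2) (insert n C) = coSum n C + n := by
  have h : ∀ i ∈ Finset.range n, (if i ∈ insert n C then 0 else i + 1) =
      if i ∈ C then 0 else i + 1 := fun i hi => by
    have : i ≠ n := (Finset.mem_range.1 hi).ne
    simp [this]
  simp only [coSum, Nat.add_succ_sub_one, Finset.sum_range_succ, Finset.mem_insert_self, if_true,
    add_zero]
  rw [Finset.sum_congr rfl h]
  cases n with
  | zero => simp
  | succ m => simp [Finset.sum_range_succ, notMem_of_mem_sparseSets hC le_rfl]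

/-- The generating polynomial of sparse sets. -/
noncomputable def sparsePoly (n : ℕ) : MvPolynomial (Fin 3) ℤ :=
  ∑ A ∈ sparseSets n, X 0 ^ (n - 2 * A.card) * X 1 ^ A.card * X 2 ^ coSum n A

lemma sum_S123_eq_sparsePoly (n : ℕ) :
    (∑ σ ∈ S123 n, X 0 ^ (n - 2 * ascStat σ) * X 1 ^ ascStat σ * X 2 ^ majStat σ :
      MvPolynomial (Fin 3) ℤ) = sparsePoly n := by
  refine Finset.sum_nbij ascSet (fun σ hσ => ascSet_mem_sparseSets hσ) (ascSet_injOn n)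
    (fun A hA => exists_mem_S123_of_mem_sparseSets hA) fun σ _ => ?_
  rw [majStat_eq_coSum]
  rfl

lemma sparsePoly_add_two (n : ℕ) :
    sparsePoly (n + 2) =
      X 0 * X 2 ^ (n + 1) * sparsePoly (n + 1) + X 1 * X 2 ^ n * sparsePoly n := by
  have hdisj : Disjoint (sparseSets (n + 1)) ((sparseSets n).image (insert n)) := by
    rw [Finset.disjoint_right]
    intro A hA hA'
    obtain ⟨C, -, rfl⟩ := Finset.mem_image.1 hA
    exact notMem_of_mem_sparseSets hA' le_rfl (Finset.mem_insert_self n C)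
  have hinj : Set.InjOn (insert n) (sparseSets n : Set (Finset ℕ)) := by
    intro C hC D hD h
    rw [← Finset.erase_insert (notMem_of_mem_sparseSets hC (Nat.le_succ n)), h,
      Finset.erase_insert (notMem_of_mem_sparseSets hD (Nat.le_succ n))]
  unfold sparsePoly
  rw [sparseSets_add_two, Finset.sum_union hdisj, Finset.sum_image hinj, Finset.mul_sum,
    Finset.mul_sum]
  congr 1
  · refine Finset.sum_congr rfl fun A hA => ?_
    have := two_mul_card_le_of_mem_sparseSets hA
    rw [coSum_add_two_of_mem hA, show n + 2 - 2 * A.card = n + 1 - 2 * A.card + 1 by omega]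
    ring
  · refine Finset.sum_congr rfl fun C hC => ?_
    rw [coSum_add_two_insert hC,
      Finset.card_insert_of_notMem (notMem_of_mem_sparseSets hC (Nat.le_succ n)),
      show n + 2 - 2 * (C.card + 1) = n - 2 * C.card by omega]
    ring

lemma mem_intervalParts {n : ℕ} {L : List ℕ} :
    L ∈ intervalParts n ↔ (∀ a ∈ L, a = 1 ∨ a = 2) ∧ L.sum = n := by
  simp only [intervalParts, Finset.mem_filter, Finset.mem_biUnion, Finset.mem_range,
    Finset.mem_image, Finset.mem_univ, true_and]
  refine and_congr_left fun hsum => ⟨?_, fun h => ?_⟩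
  · rintro ⟨k, -, v, rfl⟩ a ha
    obtain ⟨b, -, rfl⟩ := List.mem_map.1 ha
    cases b <;> simp
  · have hlen : L.length ≤ L.sum := by
      simpa using List.card_nsmul_le_sum L 1 fun a ha => by rcases h a ha with rfl | rfl <;> simp
    refine ⟨L.length, by omega, fun i => decide (L.get i = 2), ?_⟩
    refine List.ext_get (by simp) fun i h1 h2 => ?_
    rcases h _ (List.getElem_mem h2) with h' | h' <;> simp [h']

lemma blockIdx_append_singleton (L : List ℕ) (a i : ℕ) :
    blockIdx (L ++ [a]) i = blockIdx L i + if L.sum + a ≤ i then 1 else 0 := by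
  have hsum : ∀ (L : List ℕ) (b : ℕ), List.foldl (· + ·) b L = b + L.sum := by
    intro L
    induction L with
    | nil => simp
    | cons c L ih => intro b; simp [ih, add_assoc]
  have hscan : ∀ (L : List ℕ) (b : ℕ), (L ++ [a]).scanl (· + ·) b =
      L.scanl (· + ·) b ++ [b + L.sum + a] := by
    intro L
    induction L with
    | nil => simp
    | cons c L ih => intro b; simp [ih, add_assoc]
  unfold blockIdx
  rw [hscan, List.tail_append_of_ne_nil (by simp), List.countP_append]
  simp [List.countP_cons]

lemma blockIdx_le_length (L : List ℕ) (i : ℕ) : blockIdx L i ≤ L.length := by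
  refine List.countP_le_length.trans ?_
  simp

lemma blockIdx_mono (L : List ℕ) : Monotone (blockIdx L) := by
  intro i j hij
  refine List.countP_mono_left fun s _ hs => ?_
  simp only [decide_eq_true_eq] at hs ⊢
  omega

lemma blockIdx_of_sum_le (L : List ℕ) {i : ℕ} (hi : L.sum ≤ i) : blockIdx L i = L.length := by
  induction L using List.reverseRecOn with
  | nil => simp [blockIdx]
  | append_singleton L a ih =>
    simp only [List.sum_append, List.sum_singleton] at hi
    simp [blockIdx_append_singleton, hi, ih (by omega)]

lemma blockIdx_lt_length (L : List ℕ) {i : ℕ} (hi : i < L.sum) : blockIdx L i < L.length := by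
  induction L using List.reverseRecOn with
  | nil => simp at hi
  | append_singleton L a ih =>
    simp only [List.sum_append, List.sum_singleton] at hi
    have := blockIdx_le_length L i
    rw [blockIdx_append_singleton, if_neg (by omega)]
    simp
    omega

lemma exists_blockIdx_eq (L : List ℕ) (hL : ∀ a ∈ L, 0 < a) {j : ℕ} (hj : j < L.length) :
    ∃ c < L.sum, blockIdx L c = j := by
  induction L using List.reverseRecOn with
  | nil => simp at hj
  | append_singleton L a ih =>
    have ha : 0 < a := hL a (by simp)
    simp only [List.length_append, List.length_singleton] at hj
    simp only [List.sum_append, List.sum_singleton, blockIdx_append_singleton]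
    rcases Nat.lt_succ_iff_lt_or_eq.1 hj with hj | rfl
    · obtain ⟨c, hc, h⟩ := ih (fun a ha => hL a (by simp [ha])) hj
      exact ⟨c, by omega, by rw [h, if_neg (by omega), add_zero]⟩
    · exact ⟨L.sum, by omega, by rw [blockIdx_of_sum_le L le_rfl, if_neg (by omega), add_zero]⟩

lemma rbL_eq_sum (L : List ℕ) (hL : ∀ a ∈ L, 0 < a) :
    rbL L.sum L = ∑ i ∈ Finset.range L.sum, (L.length - 1 - blockIdx L i) := by
  unfold rbL
  rw [Finset.card_filter, Finset.sum_product]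
  refine Finset.sum_congr rfl fun i _ => ?_
  rw [← Finset.card_filter,
    show L.length - 1 - blockIdx L i = (Finset.Ioo (blockIdx L i) L.length).card by
      rw [Nat.card_Ioo]; omega]
  congr 1
  ext j
  simp only [Finset.mem_filter, Finset.mem_range, Finset.mem_Ioo]
  refine ⟨fun h => ⟨h.2.1, h.1⟩, fun h => ⟨h.2, h.1, ?_⟩⟩
  obtain ⟨c, hc, hcj⟩ := exists_blockIdx_eq L hL h.2
  refine ⟨c, Finset.mem_filter.2 ⟨Finset.mem_range.2 hc, hcj, ?_⟩⟩
  by_contra hle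
  have := blockIdx_mono L (not_lt.1 hle)
  omega

lemma rbL_append_singleton (L : List ℕ) (hL : ∀ a ∈ L, 0 < a) {a : ℕ} (ha : 0 < a) :
    rbL (L.sum + a) (L ++ [a]) = rbL L.sum L + L.sum := by
  have h := rbL_eq_sum (L ++ [a]) (by
    intro b hb
    rcases List.mem_append.1 hb with hb | hb
    · exact hL b hb
    · rwa [List.mem_singleton.1 hb])
  simp only [List.sum_append, List.sum_singleton, List.length_append, List.length_singleton,
    Nat.add_sub_cancel] at h
  rw [h, rbL_eq_sum L hL, Finset.sum_range_add]
  have h2 : ∑ i ∈ Finset.range a, (L.length - blockIdx (L ++ [a]) (L.sum + i)) = 0 := by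
    refine Finset.sum_eq_zero fun i _ => ?_
    rw [blockIdx_append_singleton, blockIdx_of_sum_le L (by omega)]
    omega
  rw [h2, add_zero]
  trans ∑ i ∈ Finset.range L.sum, (L.length - 1 - blockIdx L i + 1)
  swap
  · simp [Finset.sum_add_distrib]
  refine Finset.sum_congr rfl fun i hi => ?_
  have hi := Finset.mem_range.1 hi
  have := blockIdx_lt_length L hi
  rw [blockIdx_append_singleton, if_neg (by omega)]
  omega

/-- The generating polynomial of interval partitions. -/
noncomputable def intervalPoly (n : ℕ) : MvPolynomial (Fin 3) ℤ :=
  ∑ L ∈ intervalParts n, X 0 ^ L.count 1 * X 1 ^ L.count 2 * X 2 ^ rbL n L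

lemma intervalParts_add_two (n : ℕ) :
    intervalParts (n + 2) =
      (intervalParts (n + 1)).image (· ++ [1]) ∪ (intervalParts n).image (· ++ [2]) := by
  ext L
  simp only [Finset.mem_union, Finset.mem_image, mem_intervalParts]
  constructor
  · rintro ⟨h, hsum⟩
    rcases List.eq_nil_or_concat' L with rfl | ⟨L', a, rfl⟩
    · simp at hsum
    · simp only [List.sum_append, List.sum_singleton] at hsum
      have h' : ∀ b ∈ L', b = 1 ∨ b = 2 := fun b hb => h b (by simp [hb])
      rcases h a (by simp) with rfl | rfl
      · exact Or.inl ⟨L', ⟨h', by omega⟩, rfl⟩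
      · exact Or.inr ⟨L', ⟨h', by omega⟩, rfl⟩
  · rintro (⟨L, ⟨h, hsum⟩, rfl⟩ | ⟨L, ⟨h, hsum⟩, rfl⟩) <;>
    · refine ⟨fun b hb => ?_, by simp [hsum]⟩
      rcases List.mem_append.1 hb with hb | hb
      · exact h b hb
      · simp [List.mem_singleton.1 hb]

lemma intervalPoly_add_two (n : ℕ) :
    intervalPoly (n + 2) =
      X 0 * X 2 ^ (n + 1) * intervalPoly (n + 1) + X 1 * X 2 ^ n * intervalPoly n := by
  have hdisj : Disjoint ((intervalParts (n + 1)).image (· ++ [1]))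
      ((intervalParts n).image (· ++ [2])) := by
    rw [Finset.disjoint_left]
    intro L hL hL'
    obtain ⟨L₁, -, rfl⟩ := Finset.mem_image.1 hL
    obtain ⟨L₂, -, h⟩ := Finset.mem_image.1 hL'
    simpa using (List.append_inj' h rfl).2
  have hpos : ∀ {m : ℕ} {L : List ℕ}, L ∈ intervalParts m → ∀ a ∈ L, 0 < a := by
    intro m L hL a ha
    rcases (mem_intervalParts.1 hL).1 a ha with rfl | rfl <;> simp
  unfold intervalPoly
  rw [intervalParts_add_two, Finset.sum_union hdisj,
    Finset.sum_image fun _ _ _ _ h => List.append_cancel_right h,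
    Finset.sum_image fun _ _ _ _ h => List.append_cancel_right h, Finset.mul_sum, Finset.mul_sum]
  congr 1
  · refine Finset.sum_congr rfl fun L hL => ?_
    have hrb := rbL_append_singleton L (hpos hL) one_pos
    rw [(mem_intervalParts.1 hL).2, add_assoc, one_add_one_eq_two] at hrb
    rw [hrb]
    simp only [List.count_append, List.count_singleton]
    norm_num
    ring
  · refine Finset.sum_congr rfl fun L hL => ?_
    have hrb := rbL_append_singleton L (hpos hL) two_pos
    rw [(mem_intervalParts.1 hL).2] at hrb
    rw [hrb]
    simp only [List.count_append, List.count_singleton]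
    norm_num
    ring

lemma sparseSets_of_le_one {n : ℕ} (hn : n ≤ 1) : sparseSets n = {∅} := by
  ext A
  rw [mem_sparseSets, Finset.mem_singleton]
  refine ⟨fun h => Finset.eq_empty_of_forall_notMem fun i hi => ?_, ?_⟩
  · have := h.1 i hi
    omega
  · rintro rfl
    simp

lemma intervalParts_zero : intervalParts 0 = {[]} := by
  ext L
  rw [mem_intervalParts, Finset.mem_singleton]
  refine ⟨fun ⟨h, hsum⟩ => List.eq_nil_iff_forall_not_mem.2 fun a ha => ?_, ?_⟩
  · have := List.le_sum_of_mem ha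
    have := h a ha
    omega
  · rintro rfl
    simp

lemma intervalParts_one : intervalParts 1 = {[1]} := by
  ext L
  rw [mem_intervalParts, Finset.mem_singleton]
  constructor
  · rintro ⟨h, hsum⟩
    match L, h, hsum with
    | a :: L, h, hsum =>
      have ha := h a (by simp)
      simp only [List.sum_cons] at hsum
      have hL : L ∈ intervalParts 0 :=
        mem_intervalParts.2 ⟨fun b hb => h b (by simp [hb]), by omega⟩
      rw [intervalParts_zero, Finset.mem_singleton] at hL
      subst hL
      simpa using hsum
  · rintro rfl
    simp

lemma sparsePoly_eq_intervalPoly : ∀ n, sparsePoly n = intervalPoly n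
  | 0 => by
    simp [sparsePoly, intervalPoly, sparseSets_of_le_one, intervalParts_zero, coSum, rbL]
  | 1 => by
    have hrb : rbL 1 [1] = 0 := by
      have h0 : rbL 0 [] = 0 := by simp [rbL]
      exact (rbL_append_singleton [] (by simp) one_pos).trans h0
    simp [sparsePoly, intervalPoly, sparseSets_of_le_one, intervalParts_one, coSum, hrb]
  | n + 2 => by
    rw [sparsePoly_add_two, intervalPoly_add_two, sparsePoly_eq_intervalPoly (n + 1),
      sparsePoly_eq_intervalPoly n]

/-- `Σ_{σ ∈ Sₙ(123,132,213)} x^(s σ) y^(d σ) q^(maj σ) = Σ_α x^(s α) y^(d α) q^(rb α)`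
in `ℤ[x,y,q]`, where `α` runs over the partitions of `[n]` into consecutive intervals of
size at most 2 (encoded by their size lists), `s α` / `d α` being the numbers of singleton
/ doubleton blocks. -/
theorem stmt7 (n : ℕ) :
    ((∑ σ ∈ S123 n, X 0 ^ (n - 2 * ascStat σ) * X 1 ^ ascStat σ * X 2 ^ majStat σ :
          MvPolynomial (Fin 3) ℤ))
      = ∑ L ∈ intervalParts n, X 0 ^ L.count 1 * X 1 ^ L.count 2 * X 2 ^ rbL n L := by
  exact (sum_S123_eq_sparsePoly n).trans (sparsePoly_eq_intervalPoly n)
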